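/- If α is a real constant with 0 < α < 1, then lim_{n→∞} |Λ_n(⌊αn⌋) \ Π_n(⌊αn⌋)| / n! = lim_{n→∞} |Λ_n(⌊αn⌋)| / n!; that is, the success probability lim_{n→∞} P_{n,τ}(α) of the stopping rule τ_n(α) equals the limit of |Λ_n(⌊αn⌋)| / |Ω_n|. -/

import Mathlib

open Finset

namespace Secretary

/-- Relative rank of `x` with regard to `P`: the number of `z ∈ P` with `z ≤ x`
(as an integer, so that differences can be computed in `ℤ`). -/
def rr {n : ℕ} (P : Finset (Fin n)) (x : Fin n) : ℤ :=
  ((P.filter fun z => z ≤ x).card : ℤ)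

/-- `Δ(k) = {-1, 1, k-1, 1-k} ⊆ ℤ`. -/
def Δ (k : ℕ) : Finset ℤ := {-1, 1, (k : ℤ) - 1, 1 - (k : ℤ)}

/-- `{x, y} ∈ Adj(P)`: both belong to `P` and the difference of their relative
ranks with regard to `P` (in one of the two orders) lies in `Δ(|P|)`. -/
def Adj {n : ℕ} (P : Finset (Fin n)) (x y : Fin n) : Prop :=
  x ∈ P ∧ y ∈ P ∧ (rr P x - rr P y ∈ Δ P.card ∨ rr P y - rr P x ∈ Δ P.card)

instance {n : ℕ} (P : Finset (Fin n)) (x y : Fin n) : Decidable (Adj P x y) := by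
  unfold Adj; infer_instance

/-- `Ω n`: the sequences of `n` distinct applicants (as injective, hence
bijective, functions `Fin n → Fin n`); `|Ω n| = n!`. -/
def Ω (n : ℕ) : Finset (Fin n → Fin n) :=
  Finset.univ.filter Function.Injective

/-- The `i`-th applicant of the sequence `x`, with the 1-based indexing
`x_1, …, x_n` of the paper. -/
def get {n : ℕ} [NeZero n] (x : Fin n → Fin n) (i : ℕ) : Fin n :=
  x ⟨(i - 1) % n, Nat.mod_lt _ (Nat.pos_of_ne_zero (NeZero.ne n))⟩

/-- The set `{x_1, …, x_i}` of the first `i` applicants of the sequence `x`. -/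
def pre {n : ℕ} (x : Fin n → Fin n) (i : ℕ) : Finset (Fin n) :=
  (Finset.univ.filter fun j : Fin n => (j : ℕ) < i).image x

/-- `Λ_n(r,k)`: sequences `x ∈ Ω_n` with `{x_k, x_{k+1}} ∈ Adj(C_n)` and
`{x_{i-1}, x_i} ∉ Adj({x_1,…,x_i})` for all `i ∈ {r,…,k}`. -/
def Lam : (n : ℕ) → ℕ → ℕ → Finset (Fin n → Fin n)
  | 0, _, _ => ∅
  | (m + 1), r, k =>
      (Ω (m + 1)).filter fun x =>
        Adj Finset.univ (get x k) (get x (k + 1)) ∧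
          ∀ i, i ≤ k → r ≤ i → ¬ Adj (pre x i) (get x (i - 1)) (get x i)

/-- `Λ_n(r) = ⋃_{k=r}^{n-1} Λ_n(r,k)`. -/
def LamU (n : ℕ) (r : ℕ) : Finset (Fin n → Fin n) :=
  (Finset.Icc r (n - 1)).biUnion fun k => Lam n r k

/-- `Π_n(r)`: those `x ∈ Λ_n(r)` such that for the (unique) `k` with
`x ∈ Λ_n(r,k)` one has `rr_n(x_k) - rr_n(x_{k+1}) ∈ {1-n, n-1}`. -/
def Pi' : (n : ℕ) → ℕ → Finset (Fin n → Fin n)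
  | 0, _ => ∅
  | (m + 1), r =>
      (LamU (m + 1) r).filter fun x =>
        ∃ k ∈ Finset.Icc r m, x ∈ Lam (m + 1) r k ∧
          rr Finset.univ (get x k) - rr Finset.univ (get x (k + 1)) ∈
            ({1 - ((m : ℤ) + 1), ((m : ℤ) + 1) - 1} : Finset ℤ)

/-- `Λ_n(r,k,z,z̄)`: sequences of `Λ_n(r,k)` with `x_k = z` and `x_{k+1} = z̄`. -/
def Lam4 : (n : ℕ) → ℕ → ℕ → Fin n → Fin n → Finset (Fin n → Fin n)
  | 0, _, _, z, _ => z.elim0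
  | (m + 1), r, k, z, w =>
      (Lam (m + 1) r k).filter fun x => get x k = z ∧ get x (k + 1) = w

/-- `z` lies strictly between `a` and `b` when going upwards cyclically from `a` to `b`. -/
def CyclicBtw {n : ℕ} (a z b : Fin n) : Prop :=
  (a < z ∧ z < b) ∨ (z < b ∧ b < a) ∨ (b < a ∧ a < z)

/-- The cyclic neighbour relation on `Fin n`. -/
def CyclicAdj {n : ℕ} (a b : Fin n) : Prop :=
  (∀ z, ¬ CyclicBtw a z b) ∨ ∀ z, ¬ CyclicBtw b z a

/-- The values `x i` and `x j` are separated on both sides of the cycle by values of `x` at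
positions up to `j`. -/
def Separated {n : ℕ} (x : Fin n → Fin n) (i j : Fin n) : Prop :=
  (∃ u ≤ j, CyclicBtw (x i) (x u) (x j)) ∧ ∃ v ≤ j, CyclicBtw (x j) (x v) (x i)

/-- No two consecutive applicants `x_{i-1}, x_i` with `r ≤ i ≤ k` are cyclic neighbours among the
first `i` applicants. -/
def Avoids {n : ℕ} (r k : ℕ) (x : Fin n → Fin n) : Prop :=
  ∀ i j : Fin n, (j : ℕ) = i + 1 → r ≤ j + 1 → (j : ℕ) + 1 ≤ k → Separated x i j

/-- Predicates on sequences that are invariant under rotating all the values. -/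
def RotInvariant {m : ℕ} (Q : (Fin (m + 1) → Fin (m + 1)) → Prop) : Prop :=
  ∀ x c, Q (fun i => x i + c) ↔ Q x

theorem rr_sub_rr {n : ℕ} (P : Finset (Fin n)) {a b : Fin n} (hab : a < b) :
    rr P b - rr P a = ((P.filter fun z => a < z ∧ z ≤ b).card : ℤ) := by
  have h : (P.filter fun z => z ≤ b).card
      = (P.filter fun z => z ≤ a).card + (P.filter fun z => a < z ∧ z ≤ b).card := by
    rw [← card_union_of_disjoint]
    · congr 1
      ext z
      simp only [mem_filter, mem_union]
      grind
    · rw [disjoint_left]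
      intro z
      simp only [mem_filter]
      grind
  unfold rr
  omega

theorem adj_comm {n : ℕ} (P : Finset (Fin n)) (a b : Fin n) : Adj P a b ↔ Adj P b a := by
  unfold Adj
  tauto

theorem adj_iff_of_lt {n : ℕ} {P : Finset (Fin n)} {a b : Fin n} (ha : a ∈ P) (hb : b ∈ P)
    (hab : a < b) :
    Adj P a b ↔ (∀ z ∈ P, ¬ CyclicBtw a z b) ∨ ∀ z ∈ P, ¬ CyclicBtw b z a := by
  have hd := rr_sub_rr P hab
  have hsplit := card_filter_add_card_filter_not (s := P) (fun z => a < z ∧ z ≤ b)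
  have hb' : b ∈ P.filter fun z => a < z ∧ z ≤ b := by simp [hb, hab]
  have ha' : a ∈ P.filter fun z => ¬ (a < z ∧ z ≤ b) := by simp [ha]
  have h1 := card_pos.2 ⟨b, hb'⟩
  have h2 := card_pos.2 ⟨a, ha'⟩
  have e1 : (P.filter fun z => a < z ∧ z ≤ b).card = 1 ↔ ∀ z ∈ P, ¬ CyclicBtw a z b := by
    rw [card_eq_one]
    constructor
    · rintro ⟨w, hw⟩ z hz hbt
      have hbw : b = w := by rwa [hw, mem_singleton] at hb'
      have : z ∈ P.filter fun z => a < z ∧ z ≤ b := by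
        simp only [mem_filter]; unfold CyclicBtw at hbt; grind
      have hzw : z = w := by rwa [hw, mem_singleton] at this
      unfold CyclicBtw at hbt
      grind
    · intro h
      refine ⟨b, ?_⟩
      ext z
      have := h z
      simp only [mem_filter, mem_singleton]
      unfold CyclicBtw at this
      grind
  have e2 : (P.filter fun z => ¬ (a < z ∧ z ≤ b)).card = 1 ↔ ∀ z ∈ P, ¬ CyclicBtw b z a := by
    rw [card_eq_one]
    constructor
    · rintro ⟨w, hw⟩ z hz hbt
      have haw : a = w := by rwa [hw, mem_singleton] at ha'
      have : z ∈ P.filter fun z => ¬ (a < z ∧ z ≤ b) := by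
        simp only [mem_filter]; unfold CyclicBtw at hbt; grind
      have hzw : z = w := by rwa [hw, mem_singleton] at this
      unfold CyclicBtw at hbt
      grind
    · intro h
      refine ⟨a, ?_⟩
      ext z
      have := h z
      simp only [mem_filter, mem_singleton]
      unfold CyclicBtw at this
      grind
  rw [← e1, ← e2]
  simp only [Adj, Δ, ha, hb, true_and, mem_insert, mem_singleton]
  omega

theorem adj_iff {n : ℕ} {P : Finset (Fin n)} {a b : Fin n} (ha : a ∈ P) (hb : b ∈ P)
    (hab : a ≠ b) :
    Adj P a b ↔ (∀ z ∈ P, ¬ CyclicBtw a z b) ∨ ∀ z ∈ P, ¬ CyclicBtw b z a := by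
  rcases lt_or_gt_of_ne hab with h | h
  · exact adj_iff_of_lt ha hb h
  · rw [adj_comm, adj_iff_of_lt hb ha h, or_comm]

theorem mem_Lam_iff {m r k : ℕ} (hr : 3 ≤ r) (hk : 1 ≤ k) (hkm : k ≤ m)
    (x : Fin (m + 1) → Fin (m + 1)) :
    x ∈ Lam (m + 1) r k ↔ Function.Injective x ∧ Avoids r k x ∧
      CyclicAdj (x ⟨k - 1, by omega⟩) (x ⟨k, by omega⟩) := by
  simp only [Lam, Ω, mem_filter, mem_univ, true_and]
  refine and_congr_right fun hx => ?_
  have hget : ∀ i (h : i - 1 < m + 1), get x i = x ⟨i - 1, h⟩ := by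
    intro i h
    simp [get, Nat.mod_eq_of_lt h]
  rw [and_comm]
  refine and_congr ?_ ?_
  · have key : ∀ i j : Fin (m + 1), (j : ℕ) = i + 1 →
        (¬ Adj (pre x (j + 1)) (x i) (x j) ↔ Separated x i j) := by
      intro i j hij
      have hmem : ∀ u : Fin (m + 1), u ≤ j → x u ∈ pre x (j + 1) := by
        intro u hu
        simp only [pre, mem_image, mem_filter, mem_univ, true_and]
        exact ⟨u, by have : (u : ℕ) ≤ j := hu; omega, rfl⟩
      rw [adj_iff (hmem i (by rw [Fin.le_def]; omega)) (hmem j le_rfl)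
        (fun h => by have := hx h; subst this; omega)]
      simp only [pre, mem_image, mem_filter, mem_univ, true_and, Separated, Fin.le_def, not_or,
        not_forall, not_not, Nat.lt_succ_iff]
      grind
    constructor
    · intro h i j hij h1 h2
      rw [← key i j hij]
      have := h (j + 1) h2 h1
      rw [hget _ (by omega), hget _ (by omega)] at this
      have hi : (⟨j + 1 - 1 - 1, by omega⟩ : Fin (m + 1)) = i := Fin.ext (by simp; omega)
      rwa [hi] at this
    · intro h i h1 h2
      rw [hget _ (by omega), hget _ (by omega)]
      have := (key ⟨i - 1 - 1, by omega⟩ ⟨i - 1, by omega⟩ (by simp; omega)).2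
        (h _ _ (by simp; omega) (by simp; omega) (by simp; omega))
      rw [show i - 1 + 1 = i by omega] at this
      exact this
  · rw [hget _ (by omega), hget (k + 1) (by omega), adj_iff (mem_univ _) (mem_univ _)
      (fun h => by have := hx h; simp only [Fin.mk.injEq] at this; omega)]
    simp [CyclicAdj]

theorem cyclicBtw_add {m : ℕ} (a z b c : Fin (m + 1)) :
    CyclicBtw (a + c) (z + c) (b + c) ↔ CyclicBtw a z b := by
  have h : ∀ y : Fin (m + 1), ((y + c : Fin (m + 1)) : ℕ)
      = if (y : ℕ) + c < m + 1 then (y : ℕ) + c else y + c - (m + 1) := by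
    intro y
    rw [Fin.val_add_eq_ite]
    split_ifs <;> omega
  simp only [CyclicBtw, Fin.lt_def, h]
  have := a.2
  have := z.2
  have := b.2
  have := c.2
  split_ifs <;> omega

theorem separated_add {m : ℕ} (x : Fin (m + 1) → Fin (m + 1)) (c i j : Fin (m + 1)) :
    Separated (fun i => x i + c) i j ↔ Separated x i j := by
  simp only [Separated, cyclicBtw_add]

theorem rotInvariant_avoids {m : ℕ} (r k : ℕ) : RotInvariant (m := m) (Avoids r k) := by
  intro x c
  simp only [Avoids, separated_add]

theorem cyclicAdj_add {m : ℕ} (a b c : Fin (m + 1)) :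
    CyclicAdj (a + c) (b + c) ↔ CyclicAdj a b := by
  have h : ∀ a b : Fin (m + 1), (∀ z, ¬ CyclicBtw (a + c) z (b + c)) ↔ ∀ z, ¬ CyclicBtw a z b := by
    intro a b
    rw [← (Equiv.addRight c).forall_congr_right]
    simp only [Equiv.coe_addRight, cyclicBtw_add]
  rw [CyclicAdj, CyclicAdj, h, h]

theorem rotInvariant_avoids_and_cyclicAdj {m : ℕ} (r k : ℕ) (i j : Fin (m + 1)) :
    RotInvariant (fun x => Avoids r k x ∧ CyclicAdj (x i) (x j)) := by
  intro x c
  simp only [rotInvariant_avoids r k x c, cyclicAdj_add]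

open Classical in
/-- The number of sequences of distinct applicants satisfying `Q`. -/
noncomputable def injCount {n : ℕ} (Q : (Fin n → Fin n) → Prop) : ℕ :=
  #{x | Function.Injective x ∧ Q x}

theorem injCount_true (n : ℕ) : injCount (fun _ : Fin n → Fin n => True) = n.factorial := by
  classical
  simp only [injCount, and_true]
  rw [← Fintype.card_subtype,
    Fintype.card_congr (Equiv.subtypeInjectiveEquivEmbedding (Fin n) (Fin n)),
    Fintype.card_embedding_eq]
  simp [Nat.descFactorial_self]

theorem injCount_eq_const {m : ℕ} {Q : (Fin (m + 1) → Fin (m + 1)) → Prop}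
    (hQ : RotInvariant Q) (p v w : Fin (m + 1)) :
    injCount (fun x => Q x ∧ x p = v) = injCount (fun x => Q x ∧ x p = w) := by
  classical
  have hmem : ∀ v w : Fin (m + 1), ∀ x : Fin (m + 1) → Fin (m + 1),
      Function.Injective x ∧ Q x ∧ x p = v →
      Function.Injective (fun i => x i + (w - v)) ∧ Q (fun i => x i + (w - v)) ∧
        x p + (w - v) = w := by
    rintro v w x ⟨h1, h2, h3⟩
    exact ⟨fun i j h => h1 (add_right_cancel h), (hQ x _).2 h2, by rw [h3, add_sub_cancel]⟩
  refine card_bij' (fun x _ i => x i + (w - v)) (fun x _ i => x i + (v - w)) ?_ ?_ ?_ ?_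
  · simpa only [mem_filter, mem_univ, true_and] using hmem v w
  · simpa only [mem_filter, mem_univ, true_and] using hmem w v
  · intro x _
    funext i
    rw [add_assoc, sub_add_sub_cancel, sub_self, add_zero]
  · intro x _
    funext i
    rw [add_assoc, sub_add_sub_cancel, sub_self, add_zero]

theorem injCount_mem {m : ℕ} {Q : (Fin (m + 1) → Fin (m + 1)) → Prop}
    (hQ : RotInvariant Q) (p v : Fin (m + 1)) (T : Finset (Fin (m + 1))) :
    injCount (fun x => Q x ∧ x p ∈ T) = #T * injCount (fun x => Q x ∧ x p = v) := by
  classical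
  rw [injCount, card_eq_sum_card_fiberwise (f := fun x => x p) (t := T)]
  · rw [← smul_eq_mul, ← sum_const]
    refine sum_congr rfl fun w hw => ?_
    rw [injCount_eq_const hQ p v w, filter_filter, injCount]
    congr 1
    ext x
    simp only [mem_filter, mem_univ, true_and]
    grind
  · intro x hx
    simp only [coe_filter, mem_univ, true_and, Set.mem_ofPred_eq] at hx
    exact hx.2.2

theorem injCount_eq_card_mul {m : ℕ} {Q : (Fin (m + 1) → Fin (m + 1)) → Prop}
    (hQ : RotInvariant Q) (p v : Fin (m + 1)) :
    injCount Q = (m + 1) * injCount (fun x => Q x ∧ x p = v) := by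
  simpa using injCount_mem hQ p v univ

theorem injCount_mem_mul {m : ℕ} {Q : (Fin (m + 1) → Fin (m + 1)) → Prop}
    (hQ : RotInvariant Q) (p : Fin (m + 1)) (T : Finset (Fin (m + 1))) :
    injCount (fun x => Q x ∧ x p ∈ T) * (m + 1) = #T * injCount Q := by
  rw [injCount_mem hQ p 0 T, injCount_eq_card_mul hQ p 0]
  ring

/-- Insert the best applicant at position `p` into a sequence. -/
def insertTop {m : ℕ} (p : Fin (m + 1)) (y : Fin m → Fin m) : Fin (m + 1) → Fin (m + 1) :=
  p.insertNth (Fin.last m) fun i => (y i).castSucc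

theorem insertTop_self {m : ℕ} (p : Fin (m + 1)) (y : Fin m → Fin m) :
    insertTop p y p = Fin.last m := by
  simp [insertTop]

theorem insertTop_succAbove {m : ℕ} (p : Fin (m + 1)) (y : Fin m → Fin m) (i : Fin m) :
    insertTop p y (p.succAbove i) = (y i).castSucc := by
  simp [insertTop]

theorem insertTop_castSucc {m : ℕ} {p : Fin (m + 1)} (y : Fin m → Fin m) {i : Fin m}
    (h : i.castSucc < p) : insertTop p y i.castSucc = (y i).castSucc := by
  rw [← insertTop_succAbove p, Fin.succAbove_of_castSucc_lt _ _ h]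

theorem insertTop_injective {m : ℕ} (p : Fin (m + 1)) {y : Fin m → Fin m}
    (hy : Function.Injective y) : Function.Injective (insertTop p y) := by
  intro i j h
  induction i using Fin.succAboveCases p with
  | x =>
    induction j using Fin.succAboveCases p with
    | x => rfl
    | p j =>
      rw [insertTop_self, insertTop_succAbove] at h
      exact absurd h.symm (Fin.castSucc_ne_last _)
  | p i =>
    induction j using Fin.succAboveCases p with
    | x =>
      rw [insertTop_self, insertTop_succAbove] at h
      exact absurd h (Fin.castSucc_ne_last _)
    | p j =>
      rw [insertTop_succAbove, insertTop_succAbove] at h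
      rw [hy (Fin.castSucc_injective _ h)]

theorem injCount_last {m : ℕ} (p : Fin (m + 1)) {Q : (Fin (m + 1) → Fin (m + 1)) → Prop}
    {R : (Fin m → Fin m) → Prop} (h : ∀ y, Function.Injective y → (Q (insertTop p y) ↔ R y)) :
    injCount (fun x => Q x ∧ x p = Fin.last m) = injCount R := by
  classical
  symm
  refine card_bij (fun y _ => insertTop p y) ?_ ?_ ?_
  · simp only [mem_filter, mem_univ, true_and]
    exact fun y hy => ⟨insertTop_injective p hy.1, (h y hy.1).2 hy.2, insertTop_self p y⟩
  · intro y _ y' _ hyy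
    funext i
    have := congrFun hyy (p.succAbove i)
    rw [insertTop_succAbove, insertTop_succAbove] at this
    exact Fin.castSucc_injective _ this
  · simp only [mem_filter, mem_univ, true_and]
    rintro x ⟨hx, hQ, hp⟩
    have hne : ∀ i, x (p.succAbove i) ≠ Fin.last m := fun i hi =>
      Fin.succAbove_ne p i (hx (hi.trans hp.symm))
    have heq : insertTop p (fun i => (x (p.succAbove i)).castPred (hne i)) = x := by
      funext i
      induction i using Fin.succAboveCases p with
      | x => rw [insertTop_self, hp]
      | p i => rw [insertTop_succAbove, Fin.castSucc_castPred]
    have hinj : Function.Injective (fun i => (x (p.succAbove i)).castPred (hne i)) := by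
      intro i j hij
      have := hx (Fin.castPred_inj.1 hij)
      exact Fin.succAbove_right_injective this
    exact ⟨_, ⟨hinj, (h _ hinj).1 (by rwa [heq])⟩, heq⟩

theorem injCount_eq_mul {m : ℕ} (p : Fin (m + 1)) {Q : (Fin (m + 1) → Fin (m + 1)) → Prop}
    (hQ : RotInvariant Q)
    {R : (Fin m → Fin m) → Prop} (h : ∀ y, Function.Injective y → (Q (insertTop p y) ↔ R y)) :
    injCount Q = (m + 1) * injCount R := by
  rw [injCount_eq_card_mul hQ p (Fin.last m), injCount_last p h]

theorem cyclicBtw_castSucc {m : ℕ} (a z b : Fin m) :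
    CyclicBtw a.castSucc z.castSucc b.castSucc ↔ CyclicBtw a z b := by
  simp [CyclicBtw]

theorem separated_insertTop {m : ℕ} {p : Fin (m + 1)} (y : Fin m → Fin m) {i j : Fin m}
    (hi : i ≤ j) (hj : j.castSucc < p) :
    Separated (insertTop p y) i.castSucc j.castSucc ↔ Separated y i j := by
  have hlt : ∀ u : Fin m, u ≤ j → u.castSucc < p := fun u hu =>
    lt_of_le_of_lt (Fin.castSucc_le_castSucc_iff.2 hu) hj
  have hex : ∀ S : Fin (m + 1) → Prop,
      (∃ u ≤ j.castSucc, S (insertTop p y u)) ↔ ∃ u ≤ j, S (y u).castSucc := by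
    intro S
    constructor
    · rintro ⟨u, hu, hS⟩
      have hne : u ≠ Fin.last m := (lt_of_le_of_lt hu (Fin.castSucc_lt_last j)).ne
      obtain ⟨u, rfl⟩ := Fin.exists_castSucc_eq.2 hne
      have hu' := Fin.castSucc_le_castSucc_iff.1 hu
      exact ⟨u, hu', by rwa [insertTop_castSucc y (hlt u hu')] at hS⟩
    · rintro ⟨u, hu, hS⟩
      exact ⟨u.castSucc, Fin.castSucc_le_castSucc_iff.2 hu,
        by rwa [insertTop_castSucc y (hlt u hu)]⟩
  rw [Separated, insertTop_castSucc y (hlt i hi), insertTop_castSucc y hj,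
    hex (fun z => CyclicBtw (y i).castSucc z (y j).castSucc),
    hex (fun z => CyclicBtw (y j).castSucc z (y i).castSucc)]
  simp only [cyclicBtw_castSucc, Separated]

theorem avoids_insertTop {m r k : ℕ} {p : Fin (m + 1)} (hk : k ≤ p) (y : Fin m → Fin m) :
    Avoids r k (insertTop p y) ↔ Avoids r k y := by
  have hp := p.2
  constructor
  · intro h i j hij h1 h2
    refine (separated_insertTop (p := p) y (by rw [Fin.le_def]; omega)
      (by rw [Fin.lt_def, Fin.val_castSucc]; omega)).1 (h _ _ hij h1 h2)
  · intro h i j hij h1 h2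
    exact (separated_insertTop (p := p) (i := ⟨i, by omega⟩) (j := ⟨j, by omega⟩) y
      (by rw [Fin.le_def]; simp; omega) (by rw [Fin.lt_def]; simp; omega)).2 (h _ _ hij h1 h2)

theorem cyclicAdj_castSucc_last {m : ℕ} (a : Fin (m + 1)) :
    CyclicAdj a.castSucc (Fin.last (m + 1)) ↔ a ∈ ({0, Fin.last m} : Finset (Fin (m + 1))) := by
  simp only [mem_insert, mem_singleton]
  constructor
  · rintro (h | h)
    · right
      by_contra hne
      refine h (Fin.last m).castSucc (Or.inl ⟨?_, Fin.castSucc_lt_last _⟩)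
      exact Fin.castSucc_lt_castSucc_iff.2 (Fin.lt_last_iff_ne_last.2 hne)
    · left
      by_contra hne
      refine h 0 (Or.inr (Or.inl ⟨?_, Fin.castSucc_lt_last _⟩))
      have := Fin.pos_iff_ne_zero.2 hne
      rw [Fin.lt_def] at this ⊢
      simpa using this
  · rintro (rfl | rfl)
    · right
      intro z
      have := z.2
      simp only [CyclicBtw, Fin.lt_def, Fin.val_last, Fin.val_castSucc, Fin.val_zero]
      omega
    · left
      intro z
      have := z.2
      simp only [CyclicBtw, Fin.lt_def, Fin.val_last, Fin.val_castSucc]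
      omega

theorem separated_last_iff {m : ℕ} {x : Fin (m + 1) → Fin (m + 1)} (hx : Function.Injective x)
    (i : Fin (m + 1)) : Separated x i (Fin.last m) ↔ ¬ CyclicAdj (x i) (x (Fin.last m)) := by
  have hs := Finite.surjective_of_injective hx
  simp only [Separated, CyclicAdj, Fin.le_last, true_and, not_or, not_forall, not_not]
  rw [hs.exists (p := fun z => CyclicBtw (x i) z (x (Fin.last m))),
    hs.exists (p := fun z => CyclicBtw (x (Fin.last m)) z (x i))]

theorem avoids_succ_iff {m r : ℕ} (hr : r ≤ m + 2) {x : Fin (m + 2) → Fin (m + 2)}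
    (hx : Function.Injective x) :
    Avoids r (m + 2) x ↔ Avoids r (m + 1) x ∧
      ¬ CyclicAdj (x (Fin.last m).castSucc) (x (Fin.last (m + 1))) := by
  rw [← separated_last_iff hx]
  constructor
  · intro h
    exact ⟨fun i j hij h1 h2 => h i j hij h1 (by omega), h _ _ (by simp) (by simpa) (by simp)⟩
  · rintro ⟨h, h'⟩ i j hij h1 h2
    by_cases hj : (j : ℕ) + 1 ≤ m + 1
    · exact h i j hij h1 hj
    · have e1 : j = Fin.last (m + 1) := by ext; simp; omega
      have e2 : i = (Fin.last m).castSucc := by ext; simp; omega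
      rwa [e1, e2]

theorem injCount_avoids_of_lt {n r k : ℕ} (h : k < r) :
    injCount (Avoids (n := n) r k) = n.factorial := by
  rw [← injCount_true]
  congr 1
  funext x
  exact eq_true fun i j _ h1 h2 => by omega

theorem injCount_avoids_succ {m r k : ℕ} (hk : k ≤ m) :
    injCount (Avoids (n := m + 1) r k) = (m + 1) * injCount (Avoids (n := m) r k) :=
  injCount_eq_mul ⟨k, by omega⟩ (rotInvariant_avoids r k)
    fun y _ => avoids_insertTop (by simp) y

theorem injCount_avoids_succ_succ {m r : ℕ} (hm : 1 ≤ m) (hr : r ≤ m + 2) :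
    injCount (Avoids (n := m + 2) r (m + 2)) * (m + 1)
      = (m + 2) * ((m - 1) * injCount (Avoids (n := m + 1) r (m + 1))) := by
  have hc : #({0, Fin.last m}ᶜ : Finset (Fin (m + 1))) = m - 1 := by
    rw [card_compl, card_pair (by rw [Ne, Fin.ext_iff]; simp; omega), Fintype.card_fin]
    omega
  rw [← hc, ← injCount_mem_mul (rotInvariant_avoids r (m + 1)) (Fin.last m),
    injCount_eq_mul (Fin.last (m + 1)) (rotInvariant_avoids r (m + 2)), mul_assoc]
  intro y hy
  rw [avoids_succ_iff hr (insertTop_injective _ hy), avoids_insertTop (by simp),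
    insertTop_self, insertTop_castSucc y (Fin.castSucc_lt_last _), cyclicAdj_castSucc_last,
    mem_compl]

theorem card_Lam_filter {m r k : ℕ} (hr : 3 ≤ r) (hk : 1 ≤ k) (hkm : k ≤ m)
    (R : (Fin (m + 1) → Fin (m + 1)) → Prop) [DecidablePred R] :
    #((Lam (m + 1) r k).filter R) = injCount (fun x => (Avoids r k x ∧
      CyclicAdj (x ⟨k - 1, by omega⟩) (x ⟨k, by omega⟩)) ∧ R x) := by
  classical
  rw [injCount]
  congr 1
  ext x
  rw [mem_filter, mem_Lam_iff hr hk hkm]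
  simp [and_assoc]

theorem card_Lam {m r k : ℕ} (hr : 3 ≤ r) (hk : 1 ≤ k) (hkm : k ≤ m) :
    #(Lam (m + 1) r k) = injCount (fun x : Fin (m + 1) → Fin (m + 1) => Avoids r k x ∧
      CyclicAdj (x ⟨k - 1, by omega⟩) (x ⟨k, by omega⟩)) := by
  simpa using card_Lam_filter hr hk hkm (fun _ => True)

theorem card_Lam_mul {m r k : ℕ} (hm : 1 ≤ m) (hr : 3 ≤ r) (hk : 1 ≤ k) (hkm : k ≤ m + 1) :
    #(Lam (m + 2) r k) * (m + 1) = (m + 2) * (2 * injCount (Avoids (n := m + 1) r k)) := by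
  have hc : #({0, Fin.last m} : Finset (Fin (m + 1))) = 2 :=
    card_pair (by rw [Ne, Fin.ext_iff]; simp; omega)
  have h2 := injCount_mem_mul (rotInvariant_avoids (m := m) r k) ⟨k - 1, by omega⟩ {0, Fin.last m}
  rw [hc] at h2
  rw [← h2, card_Lam hr hk hkm, injCount_eq_mul (⟨k, by omega⟩ : Fin (m + 2))
    (rotInvariant_avoids_and_cyclicAdj r k ⟨k - 1, by omega⟩ ⟨k, by omega⟩), mul_assoc]
  intro y hy
  have := insertTop_castSucc (p := (⟨k, by omega⟩ : Fin (m + 2))) y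
    (i := ⟨k - 1, by omega⟩) (by rw [Fin.lt_def]; simp; omega)
  rw [Fin.castSucc_mk] at this
  rw [avoids_insertTop (by simp), insertTop_self, this, cyclicAdj_castSucc_last]

theorem cyclicAdj_imp_not_separated {n : ℕ} {x : Fin n → Fin n} {i j : Fin n}
    (h : CyclicAdj (x i) (x j)) : ¬ Separated x i j := by
  rintro ⟨⟨u, _, hu⟩, v, _, hv⟩
  exact h.elim (fun h => h _ hu) fun h => h _ hv

theorem card_LamU {m r : ℕ} (hr : 3 ≤ r) :
    #(LamU (m + 1) r) = ∑ k ∈ Icc r m, #(Lam (m + 1) r k) := by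
  have key : ∀ k ∈ Icc r m, ∀ l ∈ Icc r m, k < l →
      Disjoint (Lam (m + 1) r k) (Lam (m + 1) r l) := by
    intro k hk l hl hkl
    rw [mem_Icc] at hk hl
    rw [disjoint_left]
    intro x hx hx'
    rw [mem_Lam_iff hr (by omega) (by omega)] at hx hx'
    exact cyclicAdj_imp_not_separated hx.2.2
      (hx'.2.1 _ _ (by simp; omega) (by simp; omega) (by simp; omega))
  refine card_biUnion fun k hk l hl hkl => ?_
  rcases lt_or_gt_of_ne hkl with h | h
  · exact key k hk l hl h
  · exact (key l hl k hk h).symm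

theorem rr_univ {n : ℕ} (x : Fin n) : rr univ x = x + 1 := by
  have : (univ.filter fun z => z ≤ x) = Iic x := by
    ext z
    simp
  rw [rr, this, Fin.card_Iic]
  push_cast
  rfl

theorem card_Pi'_mul_le {m r : ℕ} (hr : 3 ≤ r) :
    #(Pi' (m + 1) r) * (m + 1) ≤ 2 * #(LamU (m + 1) r) := by
  classical
  have hsub : Pi' (m + 1) r ⊆ (Icc r m).biUnion fun k =>
      (Lam (m + 1) r k).filter fun x => get x (k + 1) ∈ ({0, Fin.last m} : Finset _) := by
    intro x hx
    simp only [Pi', mem_filter] at hx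
    obtain ⟨-, k, hk, hxk, hd⟩ := hx
    refine mem_biUnion.2 ⟨k, hk, mem_filter.2 ⟨hxk, ?_⟩⟩
    rw [rr_univ, rr_univ] at hd
    simp only [mem_insert, mem_singleton, Fin.ext_iff, Fin.val_zero, Fin.val_last] at hd ⊢
    omega
  rw [card_LamU hr]
  calc #(Pi' (m + 1) r) * (m + 1)
      ≤ (∑ k ∈ Icc r m, #((Lam (m + 1) r k).filter fun x =>
          get x (k + 1) ∈ ({0, Fin.last m} : Finset _))) * (m + 1) :=
        Nat.mul_le_mul_right _ ((card_le_card hsub).trans card_biUnion_le)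
    _ ≤ 2 * ∑ k ∈ Icc r m, #(Lam (m + 1) r k) := by
      rw [sum_mul, mul_sum]
      refine sum_le_sum fun k hk => ?_
      rw [mem_Icc] at hk
      rw [card_Lam_filter hr (by omega) hk.2, card_Lam hr (by omega) hk.2]
      exact (injCount_mem_mul (rotInvariant_avoids_and_cyclicAdj r k _ _) _ _).trans_le
        (Nat.mul_le_mul_right _ card_le_two)

theorem injCount_avoids_self {r k : ℕ} (hr : 4 ≤ r) (hk : r ≤ k + 1) :
    (injCount (Avoids (n := k) r k) : ℝ) * ((k - 2) * (k - 1))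
      = (r - 3) * (r - 2) * k.factorial := by
  obtain ⟨s, rfl⟩ : ∃ s, r = s + 1 := ⟨r - 1, by omega⟩
  induction k, (by omega : s ≤ k) using Nat.le_induction with
  | base =>
    rw [injCount_avoids_of_lt (by omega)]
    push_cast
    ring
  | succ k hsk ih =>
    have ih := ih (by omega)
    obtain ⟨m, rfl⟩ : ∃ m, k = m + 1 := ⟨k - 1, by omega⟩
    have h := injCount_avoids_succ_succ (m := m) (r := s + 1) (by omega) (by omega)
    have h' : (injCount (Avoids (n := m + 2) (s + 1) (m + 2)) : ℝ) * (m + 1)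
        = (m + 2) * ((m - 1) * injCount (Avoids (n := m + 1) (s + 1) (m + 1))) := by
      have := congrArg (Nat.cast : ℕ → ℝ) h
      rw [← Nat.cast_one (R := ℝ), ← Nat.cast_sub (by omega)]
      exact_mod_cast this
    rw [Nat.factorial_succ (m + 1)]
    push_cast at ih ⊢
    linear_combination (m : ℝ) * h' + ((m : ℝ) + 2) * ih

theorem injCount_avoids {n r k : ℕ} (hr : 4 ≤ r) (hk : r ≤ k + 1) (hkn : k ≤ n) :
    (injCount (Avoids (n := n) r k) : ℝ) * ((k - 2) * (k - 1))
      = (r - 3) * (r - 2) * n.factorial := by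
  induction n, hkn using Nat.le_induction with
  | base => exact injCount_avoids_self hr hk
  | succ n hn ih =>
    rw [injCount_avoids_succ hn, Nat.factorial_succ]
    push_cast
    linear_combination ((n : ℝ) + 1) * ih

theorem card_Lam_div {m r k : ℕ} (hr : 4 ≤ r) (hk : r ≤ k) (hkm : k ≤ m + 1) :
    (#(Lam (m + 2) r k) : ℝ) / (m + 2).factorial
      = 2 * (r - 3) * (r - 2) / (m + 1) * (1 / ((k - 2) * (k - 1))) := by
  have h : (#(Lam (m + 2) r k) : ℝ) * (m + 1)
      = (m + 2) * (2 * injCount (Avoids (n := m + 1) r k)) := by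
    exact_mod_cast card_Lam_mul (m := m) (by omega) (by omega) (by omega) hkm
  have h2 := injCount_avoids hr (by omega : r ≤ k + 1) hkm
  have hk4 : (4 : ℝ) ≤ k := by exact_mod_cast hr.trans hk
  have e1 : (k : ℝ) - 2 ≠ 0 := by linarith
  have e2 : (k : ℝ) - 1 ≠ 0 := by linarith
  have e3 : (m : ℝ) + 1 ≠ 0 := by positivity
  rw [Nat.factorial_succ (m + 1)]
  push_cast
  rw [div_mul_div_comm, div_eq_div_iff (by positivity) (by positivity)]
  linear_combination ((k : ℝ) - 2) * (k - 1) * h + 2 * ((m : ℝ) + 2) * h2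

theorem sum_one_div_mul {r m : ℕ} (hr : 3 ≤ r) (hm : r ≤ m + 2) :
    ∑ k ∈ Ico r (m + 2), (1 : ℝ) / ((k - 2) * (k - 1)) = 1 / (r - 2) - 1 / m := by
  obtain ⟨s, rfl⟩ : ∃ s, r = s + 2 := ⟨r - 2, by omega⟩
  induction m, (by omega : s ≤ m) using Nat.le_induction with
  | base => simp
  | succ m hsm ih =>
    rw [show m + 1 + 2 = m + 2 + 1 by ring, sum_Ico_succ_top (by omega), ih (by omega)]
    have : (m : ℝ) ≠ 0 := by
      have : m ≠ 0 := by omega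
      exact_mod_cast this
    have h2 : (m : ℝ) + 1 ≠ 0 := by positivity
    push_cast
    rw [show (m : ℝ) + 2 - 2 = m by ring, show (m : ℝ) + 2 - 1 = m + 1 by ring]
    field_simp
    ring

theorem card_LamU_div {m r : ℕ} (hr : 4 ≤ r) (hrm : r ≤ m + 2) :
    (#(LamU (m + 2) r) : ℝ) / (m + 2).factorial
      = 2 * (r - 3) * (m + 2 - r) / ((m + 1) * m) := by
  have hm : (m : ℝ) ≠ 0 := by
    have : m ≠ 0 := by omega
    exact_mod_cast this
  have hr4 : (4 : ℝ) ≤ r := by exact_mod_cast hr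
  have e1 : (r : ℝ) - 2 ≠ 0 := by linarith
  have e2 : (m : ℝ) + 1 ≠ 0 := by positivity
  rw [card_LamU (by omega), Nat.cast_sum, sum_div,
    sum_congr rfl fun k hk => card_Lam_div hr (mem_Icc.1 hk).1 (mem_Icc.1 hk).2, ← mul_sum]
  have : Icc r (m + 1) = Ico r (m + 2) := by
    ext
    simp
    omega
  rw [this, sum_one_div_mul (by omega) hrm]
  field_simp
  ring

theorem tendsto_card_LamU_div (α : ℝ) (h0 : 0 < α) (h1 : α < 1) :
    Filter.Tendsto (fun n : ℕ => (#(LamU n ⌊α * n⌋₊) : ℝ) / (Nat.factorial n : ℝ))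
      Filter.atTop (nhds (2 * α * (1 - α))) := by
  have hn : Filter.Tendsto (fun n : ℕ => (n : ℝ)) Filter.atTop Filter.atTop :=
    tendsto_natCast_atTop_atTop
  have hi : ∀ c : ℝ, Filter.Tendsto (fun n : ℕ => c / (n : ℝ)) Filter.atTop (nhds 0) :=
    fun c => hn.const_div_atTop c
  have hf : Filter.Tendsto (fun n : ℕ => (⌊α * n⌋₊ : ℝ) / n) Filter.atTop (nhds α) :=
    (tendsto_nat_floor_mul_div_atTop h0.le).comp hn
  have hlim : Filter.Tendsto (fun n : ℕ => 2 * ((⌊α * n⌋₊ : ℝ) / n - 3 / n)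
      * (1 - (⌊α * n⌋₊ : ℝ) / n) / ((1 - 1 / n) * (1 - 2 / n)))
      Filter.atTop (nhds (2 * (α - 0) * (1 - α) / ((1 - 0) * (1 - 0)))) :=
    (((hf.sub (hi 3)).const_mul 2).mul (hf.const_sub 1)).div
      (((hi 1).const_sub 1).mul ((hi 2).const_sub 1)) (by norm_num)
  have hfl : ∀ᶠ n : ℕ in Filter.atTop, 4 ≤ ⌊α * n⌋₊ :=
    (tendsto_nat_floor_atTop.comp (hn.const_mul_atTop h0)).eventually_ge_atTop 4
  rw [show 2 * (α - 0) * (1 - α) / ((1 - 0) * (1 - 0)) = 2 * α * (1 - α) by ring] at hlim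
  refine hlim.congr' ?_
  filter_upwards [hfl, Filter.eventually_ge_atTop 3] with n h4 hn3
  obtain ⟨m, rfl⟩ : ∃ m, n = m + 2 := ⟨n - 2, by omega⟩
  have hle : ⌊α * (m + 2 : ℕ)⌋₊ ≤ m + 2 :=
    Nat.floor_le_of_le (mul_le_of_le_one_left (by positivity) h1.le)
  rw [card_LamU_div h4 hle]
  generalize ⌊α * (m + 2 : ℕ)⌋₊ = r
  have hm : (m : ℝ) ≠ 0 := by
    have : m ≠ 0 := by omega
    exact_mod_cast this
  have e2 : (m : ℝ) + 1 ≠ 0 := by positivity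
  have e3 : (m : ℝ) + 2 ≠ 0 := by positivity
  have d1 : (1 : ℝ) - 1 / (m + 2) = (m + 1) / (m + 2) := by
    field_simp
    ring
  have d2 : (1 : ℝ) - 2 / (m + 2) = m / (m + 2) := by
    field_simp
    ring
  push_cast
  rw [d1, d2]
  field_simp

/-- for real `0 < α < 1`, the limits of
`|Λ_n(⌊αn⌋) \ Π_n(⌊αn⌋)| / n!` (the success probability of `τ_n(α)`) and of
`|Λ_n(⌊αn⌋)| / n!` exist and are equal. -/
theorem statement13 (α : ℝ) (h0 : 0 < α) (h1 : α < 1) :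
    ∃ L : ℝ,
      Filter.Tendsto (fun n : ℕ =>
          ((LamU n ⌊α * n⌋₊ \ Pi' n ⌊α * n⌋₊).card : ℝ) / (Nat.factorial n : ℝ))
        Filter.atTop (nhds L) ∧
      Filter.Tendsto (fun n : ℕ =>
          ((LamU n ⌊α * n⌋₊).card : ℝ) / (Nat.factorial n : ℝ))
        Filter.atTop (nhds L) := by
  refine ⟨2 * α * (1 - α), ?_, tendsto_card_LamU_div α h0 h1⟩
  have hlim := tendsto_card_LamU_div α h0 h1
  have hn : Filter.Tendsto (fun n : ℕ => (n : ℝ)) Filter.atTop Filter.atTop :=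
    tendsto_natCast_atTop_atTop
  have hfl : ∀ᶠ n : ℕ in Filter.atTop, 3 ≤ ⌊α * n⌋₊ :=
    (tendsto_nat_floor_atTop.comp (hn.const_mul_atTop h0)).eventually_ge_atTop 3
  have hlow := hlim.sub ((hn.const_div_atTop 2).mul hlim)
  rw [zero_mul, sub_zero] at hlow
  refine tendsto_of_tendsto_of_tendsto_of_le_of_le' hlow hlim ?_ ?_
  · filter_upwards [hfl, Filter.eventually_ge_atTop 1] with n h3 hn1
    obtain ⟨m, rfl⟩ : ∃ m, n = m + 1 := ⟨n - 1, by omega⟩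
    have hP : (#(Pi' (m + 1) ⌊α * (m + 1 : ℕ)⌋₊) : ℝ) * ((m + 1 : ℕ) : ℝ)
        ≤ 2 * #(LamU (m + 1) ⌊α * (m + 1 : ℕ)⌋₊) := by
      exact_mod_cast card_Pi'_mul_le h3
    have hd : (#(LamU (m + 1) ⌊α * (m + 1 : ℕ)⌋₊) : ℝ) ≤
        #(LamU (m + 1) ⌊α * (m + 1 : ℕ)⌋₊ \ Pi' (m + 1) ⌊α * (m + 1 : ℕ)⌋₊)
          + #(Pi' (m + 1) ⌊α * (m + 1 : ℕ)⌋₊) := by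
      exact_mod_cast card_le_card_sdiff_add_card
    have hpos : (0 : ℝ) < ((m + 1 : ℕ) : ℝ) := by positivity
    rw [← mul_div_assoc, ← sub_div]
    gcongr
    rw [← le_div_iff₀ hpos] at hP
    rw [div_mul_eq_mul_div]
    linarith
  · refine Filter.Eventually.of_forall fun n => ?_
    have := card_le_card (sdiff_subset (s := LamU n ⌊α * n⌋₊) (t := Pi' n ⌊α * n⌋₊))
    gcongr
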